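/- In a free group F_N of finite rank N, the intersection of any family of free factors of F_N is again a free factor of F_N. Consequently, every subgroup H of F_N is contained in a unique minimal free factor of F_N, namely the intersection of all free factors containing H. -/

import Mathlib

/-- A subgroup A of a group G is a free factor if G splits as an (internal) free product
G = A * B for some subgroup B, i.e. the natural map A ∗ B → G is an isomorphism. -/
def IsFreeFactor {G : Type*} [Group G] (A : Subgroup G) : Prop :=
  ∃ B : Subgroup G, Function.Bijective (Monoid.Coprod.lift A.subtype B.subtype)

theorem IsFreeFactor.of_retraction {G : Type*} [Group G] {A B : Subgroup G} (hsup : A ⊔ B = ⊤)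
    (ψ : G →* Monoid.Coprod A B) (hA : ∀ a : A, ψ a = Monoid.Coprod.inl a)
    (hB : ∀ b : B, ψ b = Monoid.Coprod.inr b) : IsFreeFactor A := by
  refine ⟨B, ?_, ?_⟩
  · refine Function.LeftInverse.injective (g := ψ) fun x ↦ ?_
    have h : ψ.comp (Monoid.Coprod.lift A.subtype B.subtype) = MonoidHom.id _ :=
      Monoid.Coprod.hom_ext (by ext a; simpa using hA a) (by ext b; simpa using hB b)
    exact DFunLike.congr_fun h x
  · rw [← MonoidHom.range_eq_top, Monoid.Coprod.range_eq]
    simpa using hsup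

theorem IsFreeFactor.exists_lift {G : Type*} [Group G] {A : Subgroup G} (hA : IsFreeFactor A) :
    ∃ B : Subgroup G, A ⊔ B = ⊤ ∧ ∀ {Q : Type _} [Group Q] (f : A →* Q) (g : B →* Q),
      ∃ φ : G →* Q, (∀ a : A, φ a = f a) ∧ ∀ b : B, φ b = g b := by
  obtain ⟨B, hB⟩ := hA
  refine ⟨B, ?_, fun {Q} _ f g ↦ ?_⟩
  · have := MonoidHom.range_eq_top.2 hB.2
    rw [Monoid.Coprod.range_eq] at this
    simpa using this
  · let e := MulEquiv.ofBijective _ hB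
    refine ⟨(Monoid.Coprod.lift f g).comp e.symm.toMonoidHom, fun a ↦ ?_, fun b ↦ ?_⟩
    · have : e.symm (a : G) = Monoid.Coprod.inl a := by
        rw [MulEquiv.symm_apply_eq]; simp [e]
      simp [this]
    · have : e.symm (b : G) = Monoid.Coprod.inr b := by
        rw [MulEquiv.symm_apply_eq]; simp [e]
      simp [this]

theorem isFreeFactor_top {G : Type*} [Group G] : IsFreeFactor (⊤ : Subgroup G) :=
  .of_retraction (B := ⊥) (by simp)
    (Monoid.Coprod.inl.comp Subgroup.topEquiv.symm.toMonoidHom) (fun _ ↦ rfl) fun b ↦ by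
      obtain rfl := Subsingleton.elim b 1
      simp

theorem IsFreeFactor.map_subtype {G : Type*} [Group G] {H : Subgroup G} {K : Subgroup H}
    (hH : IsFreeFactor H) (hK : IsFreeFactor K) : IsFreeFactor (K.map H.subtype) := by
  obtain ⟨D, hHD, liftH⟩ := hH.exists_lift
  obtain ⟨B, hKB, liftK⟩ := hK.exists_lift
  let K' := K.map H.subtype
  let C := B.map H.subtype ⊔ D
  have hK' (k : K) : (k : G) ∈ K' := ⟨k, k.2, rfl⟩
  have hB (b : B) : (b : G) ∈ C := (le_sup_left : _ ≤ C) ⟨b, b.2, rfl⟩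
  have hD (d : D) : (d : G) ∈ C := (le_sup_right : _ ≤ C) d.2
  obtain ⟨φ, hφK, hφB⟩ := liftK (Q := Monoid.Coprod K' C)
    (Monoid.Coprod.inl.comp ((H.subtype.comp K.subtype).codRestrict K' hK'))
    (Monoid.Coprod.inr.comp ((H.subtype.comp B.subtype).codRestrict C hB))
  obtain ⟨ψ, hψH, hψD⟩ := liftH φ (Monoid.Coprod.inr.comp (D.subtype.codRestrict C hD))
  refine .of_retraction (B := C) ?_ ψ ?_ ?_
  · rw [← sup_assoc, ← Subgroup.map_sup, hKB, ← MonoidHom.range_eq_map, Subgroup.range_subtype, hHD]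
  · rintro ⟨_, k, hk, rfl⟩
    exact (hψH k).trans (hφK ⟨k, hk⟩)
  · have h : ψ.comp C.subtype = Monoid.Coprod.inr := by
      have hC : C ≤ (((ψ.comp C.subtype).eqLocus Monoid.Coprod.inr).map C.subtype) := by
        refine sup_le ?_ fun d hd ↦ ⟨⟨d, hD ⟨d, hd⟩⟩, hψD ⟨d, hd⟩, rfl⟩
        rintro _ ⟨b, hb, rfl⟩
        exact ⟨⟨b, hB ⟨b, hb⟩⟩, (hψH b).trans (hφB ⟨b, hb⟩), rfl⟩
      ext c
      obtain ⟨c', hc', h⟩ := hC c.2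
      obtain rfl : c' = c := Subtype.ext h
      exact hc'
    exact DFunLike.congr_fun h

/-- Distance to `P` along the edges `s ⟶ e • s`, `e ∈ E`, together with the set of points that
can be reached. -/
theorem exists_dist {G S : Type*} [Group G] [MulAction G S] (E : Set G) (P : Set S) :
    ∃ (R : Set S) (d : S → ℕ), P ⊆ R ∧ (∀ e ∈ E, ∀ s ∈ R, e • s ∈ R) ∧
      ∀ s ∈ R, s ∉ P → ∃ e ∈ E, e⁻¹ • s ∈ R ∧ d (e⁻¹ • s) < d s := by
  let reach : ℕ → S → Prop := fun n ↦ n.rec (· ∈ P) fun _ r s ↦ ∃ e ∈ E, r (e⁻¹ • s)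
  refine ⟨{s | ∃ n, reach n s}, fun s ↦ sInf {n | reach n s}, fun s hs ↦ ⟨0, hs⟩, ?_, ?_⟩
  · rintro e he s ⟨n, hn⟩
    exact ⟨n + 1, e, he, by simpa using hn⟩
  · intro s hs hP
    have hmem : reach (sInf {n | reach n s}) s := Nat.sInf_mem (s := {n | reach n s}) hs
    dsimp only
    generalize sInf {n | reach n s} = m at hmem
    cases m with
    | zero => exact absurd hmem hP
    | succ n =>
      obtain ⟨e, he, h⟩ := hmem
      exact ⟨e, he, ⟨n, h⟩, Nat.lt_succ_of_le (Nat.sInf_le h)⟩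

/-- A Schreier transversal of a transitive action which, on the orbit of the base point
under the subgroup generated by `Y`, takes values in that subgroup. -/
theorem exists_schreier_transversal {G S : Type*} [Group G] [MulAction G S]
    [MulAction.IsPretransitive G S] {X Y : Set G} (hX : Subgroup.closure X = ⊤) (hYX : Y ⊆ X)
    (o : S) :
    ∃ (R : Set S) (t : S → G), o ∈ R ∧ (∀ a ∈ Subgroup.closure Y, ∀ s ∈ R, a • s ∈ R) ∧
      t o = 1 ∧ (∀ s, t s • o = s) ∧ (∀ s ∈ R, t s ∈ Subgroup.closure Y) ∧
      ∀ P : S → Prop, P o →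
        (∀ x ∈ X, ∀ s, t (x • s) = x * t s → (P s ↔ P (x • s))) → ∀ s, P s := by
  classical
  have closed {Z : Set G} {R : Set S} (h : ∀ e ∈ Z ∪ Z⁻¹, ∀ s ∈ R, e • s ∈ R) :
      ∀ a ∈ Subgroup.closure Z, ∀ s ∈ R, a • s ∈ R := by
    intro a ha
    have ha' : a ∈ Submonoid.closure (Z ∪ Z⁻¹) := by
      rwa [← Subgroup.closure_toSubmonoid]
    induction ha' using Submonoid.closure_induction with
    | mem x hx => exact h x hx
    | one => simp
    | mul x y hx hy h1 h2 =>
      rw [← Subgroup.closure_toSubmonoid] at hx hy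
      intro s hs
      rw [mul_smul]
      exact h1 hx _ (h2 hy _ hs)
  obtain ⟨R, d, hoR, hR, hd⟩ := exists_dist (Y ∪ Y⁻¹) {o}
  obtain ⟨T, d', hRT, hT, hd'⟩ := exists_dist (X ∪ X⁻¹) R
  have hR := closed hR
  have hT : ∀ s, s ∈ T := fun s ↦ by
    obtain ⟨g, rfl⟩ := MulAction.exists_smul_eq G o s
    exact closed hT g (by simp [hX]) _ (hRT (hoR rfl))
  let D : S → Lex (ℕ × ℕ) := fun s ↦ if s ∈ R then toLex (0, d s) else toLex (1, d' s)
  have parent (s : S) : ∃ e : G, s ≠ o → e ∈ X ∪ X⁻¹ ∧ D (e⁻¹ • s) < D s ∧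
      (s ∈ R → e ∈ Y ∪ Y⁻¹ ∧ e⁻¹ • s ∈ R) := by
    by_cases hs : s = o
    · exact ⟨1, fun h ↦ absurd hs h⟩
    by_cases hsR : s ∈ R
    · obtain ⟨e, he, heR, hlt⟩ := hd s hsR hs
      refine ⟨e, fun _ ↦ ⟨?_, ?_, fun _ ↦ ⟨he, heR⟩⟩⟩
      · exact Set.union_subset_union hYX (Set.inv_subset_inv.2 hYX) he
      · simp [D, hsR, heR, Prod.Lex.toLex_lt_toLex, hlt]
    · obtain ⟨e, he, -, hlt⟩ := hd' s (hT s) hsR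
      refine ⟨e, fun _ ↦ ⟨he, ?_, fun h ↦ absurd h hsR⟩⟩
      by_cases heR : e⁻¹ • s ∈ R <;> simp [D, hsR, heR, Prod.Lex.toLex_lt_toLex, hlt]
  choose e he using parent
  have wf : WellFounded (InvImage (· < ·) D) := InvImage.wf D wellFounded_lt
  let t : S → G := wf.fix fun s rec ↦
    if h : s = o then 1 else e s * rec ((e s)⁻¹ • s) (he s h).2.1
  have ht (s : S) : t s = if s = o then 1 else e s * t ((e s)⁻¹ • s) := by
    simp only [t]
    rw [wf.fix_eq]
    split_ifs <;> rfl
  refine ⟨R, t, hoR rfl, hR, by simp [ht o], fun s ↦ ?_, fun s ↦ ?_, fun P ho hP s ↦ ?_⟩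
  · induction s using wf.induction with
    | _ s ih =>
    rw [ht]
    split_ifs with h
    · simp [h]
    · rw [mul_smul, ih _ (he s h).2.1, smul_inv_smul]
  · induction s using wf.induction with
    | _ s ih =>
    intro hs
    rw [ht]
    split_ifs with h
    · exact one_mem _
    · obtain ⟨h1, h2⟩ := (he s h).2.2 hs
      refine mul_mem ?_ (ih _ (he s h).2.1 h2)
      rcases h1 with h1 | h1
      · exact Subgroup.subset_closure h1
      · exact inv_mem_iff.1 (Subgroup.subset_closure h1)
  · induction s using wf.induction with
    | _ s ih =>
    by_cases h : s = o
    · rwa [h]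
    have hp := ih _ (he s h).2.1
    have hts := ht s
    rw [if_neg h] at hts
    rcases (he s h).1 with h1 | h1
    · have := (hP (e s) h1 ((e s)⁻¹ • s) (by simpa using hts)).1 hp
      simpa using this
    · exact (hP (e s)⁻¹ h1 s (by rw [hts, inv_mul_cancel_left])).2 hp

theorem exists_cocycle {G S Q : Type*} [Group G] [MulAction G S] [Group Q] {X : Set G}
    (hX : Subgroup.closure X = ⊤)
    (hfree : ∀ f : G → Equiv.Perm (S × Q), ∃ φ : G →* Equiv.Perm (S × Q), ∀ x ∈ X, φ x = f x)
    (c₀ : G → S → Q) :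
    ∃ c : G → S → Q, (∀ g h s, c (g * h) s = c g (h • s) * c h s) ∧
      ∀ x ∈ X, ∀ s, c x s = c₀ x s := by
  obtain ⟨φ, hφ⟩ := hfree fun x ↦
    { toFun := fun p ↦ (x • p.1, c₀ x p.1 * p.2)
      invFun := fun p ↦ (x⁻¹ • p.1, (c₀ x (x⁻¹ • p.1))⁻¹ * p.2)
      left_inv := fun p ↦ by simp
      right_inv := fun p ↦ by simp }
  have key (g : G) : ∃ c : S → Q, ∀ s q, φ g (s, q) = (g • s, c s * q) := by
    have hg : g ∈ Subgroup.closure X := hX ▸ Subgroup.mem_top g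
    induction hg using Subgroup.closure_induction with
    | mem x hx => exact ⟨c₀ x, fun s q ↦ by rw [hφ x hx]; rfl⟩
    | one => exact ⟨1, by simp⟩
    | mul x y _ _ hx hy =>
      obtain ⟨c, hc⟩ := hx
      obtain ⟨c', hc'⟩ := hy
      exact ⟨fun s ↦ c (y • s) * c' s, fun s q ↦ by simp [hc, hc', mul_smul, mul_assoc]⟩
    | inv x _ hx =>
      obtain ⟨c, hc⟩ := hx
      refine ⟨fun s ↦ (c (x⁻¹ • s))⁻¹, fun s q ↦ ?_⟩
      rw [map_inv, Equiv.Perm.inv_eq_iff_eq, hc]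
      simp
  choose c hc using key
  refine ⟨c, fun g h s ↦ ?_, fun x hx s ↦ ?_⟩
  · have := hc (g * h) s 1
    rw [map_mul, Equiv.Perm.mul_apply, hc, hc] at this
    simpa using (congrArg Prod.snd this).symm
  · have := hc x s 1
    rw [hφ x hx] at this
    simpa using (congrArg Prod.snd this).symm

theorem IsFreeGroup.closure_range_of (G : Type*) [Group G] [IsFreeGroup G] :
    Subgroup.closure (Set.range (IsFreeGroup.of : IsFreeGroup.Generators G → G)) = ⊤ := by
  have h : Set.range (IsFreeGroup.of : IsFreeGroup.Generators G → G) =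
      (IsFreeGroup.mulEquiv G).toMonoidHom '' Set.range FreeGroup.of := by
    rw [← Set.range_comp]
    rfl
  rw [h, ← MonoidHom.map_closure, FreeGroup.closure_range_of, ← MonoidHom.range_eq_map]
  exact MonoidHom.range_eq_top.2 (IsFreeGroup.mulEquiv G).surjective

/-- A free factor of a free group has a free generating set which extends to one of the group. -/
theorem IsFreeFactor.exists_generators {G : Type*} [Group G] [IsFreeGroup G] {A : Subgroup G}
    (hA : IsFreeFactor A) : ∃ X Y : Set G, Y ⊆ X ∧ Subgroup.closure Y = A ∧
      Subgroup.closure X = ⊤ ∧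
      ∀ {Q : Type _} [Group Q] (f : G → Q), ∃ φ : G →* Q, ∀ x ∈ X, φ x = f x := by
  obtain ⟨B, hAB, hlift⟩ := hA.exists_lift
  let Z (K : Subgroup G) : Set G :=
    K.subtype '' Set.range (IsFreeGroup.of : IsFreeGroup.Generators K → K)
  have hZ (K : Subgroup G) : Subgroup.closure (Z K) = K := by
    rw [← MonoidHom.map_closure, IsFreeGroup.closure_range_of, ← MonoidHom.range_eq_map,
      Subgroup.range_subtype]
  refine ⟨Z A ∪ Z B, Z A, Set.subset_union_left, hZ A, ?_, fun {Q} _ f ↦ ?_⟩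
  · rw [Subgroup.closure_union, hZ, hZ, hAB]
  · obtain ⟨φ, h1, h2⟩ := hlift
      (IsFreeGroup.lift fun i : IsFreeGroup.Generators A ↦ f (IsFreeGroup.of i : A))
      (IsFreeGroup.lift fun i : IsFreeGroup.Generators B ↦ f (IsFreeGroup.of i : B))
    refine ⟨φ, ?_⟩
    rintro _ (⟨_, ⟨i, rfl⟩, rfl⟩ | ⟨_, ⟨i, rfl⟩, rfl⟩)
    · exact (h1 _).trans (IsFreeGroup.lift_of _ _)
    · exact (h2 _).trans (IsFreeGroup.lift_of _ _)

/-- The trace of a free factor on a subgroup is a free factor of the subgroup. -/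
theorem IsFreeFactor.subgroupOf {G : Type*} [Group G] [IsFreeGroup G] {A : Subgroup G}
    (hA : IsFreeFactor A) (H : Subgroup G) : IsFreeFactor (A.subgroupOf H) := by
  classical
  obtain ⟨X, Y, hYX, rfl, hX, hfree⟩ := hA.exists_generators
  obtain ⟨R, t, hoR, hR, hto, hts, htR, hind⟩ :=
    exists_schreier_transversal hX hYX ((1 : G) : G ⧸ H)
  have hmem (g : G) (s : G ⧸ H) : (t (g • s))⁻¹ * g * t s ∈ H := by
    have h1 (s : G ⧸ H) : ((t s : G) : G ⧸ H) = s := by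
      conv_rhs => rw [← hts s]
      rw [MulAction.Quotient.smul_coe, smul_eq_mul, mul_one]
    rw [mul_assoc, ← QuotientGroup.eq, h1, ← smul_eq_mul, ← MulAction.Quotient.smul_coe, h1]
  let γ (g : G) (s : G ⧸ H) : H := ⟨(t (g • s))⁻¹ * g * t s, hmem g s⟩
  have hγ (g : G) (s : G ⧸ H) : (γ g s : G) = (t (g • s))⁻¹ * g * t s := rfl
  have γ_mul (g h : G) (s : G ⧸ H) : γ (g * h) s = γ g (h • s) * γ h s := by
    apply Subtype.ext
    simp [hγ, mul_smul, mul_assoc]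
  have γ_one (s : G ⧸ H) : γ 1 s = 1 := by
    apply Subtype.ext
    simp [hγ]
  have γ_inv (g : G) (s : G ⧸ H) : γ g⁻¹ s = (γ g (g⁻¹ • s))⁻¹ :=
    eq_inv_of_mul_eq_one_right (by rw [← γ_mul, mul_inv_cancel, γ_one])
  let K := (Subgroup.closure Y).subgroupOf H
  have hK {a : G} (ha : a ∈ Subgroup.closure Y) {s : G ⧸ H} (hs : s ∈ R) : γ a s ∈ K :=
    Subgroup.mem_subgroupOf.2
      (mul_mem (mul_mem (inv_mem (htR _ (hR a ha s hs))) ha) (htR s hs))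
  let B : Subgroup H := Subgroup.closure
    {h | ∃ x ∈ X, ∃ s, ¬(x ∈ Y ∧ s ∈ R) ∧ h = γ x s}
  have label (g : G) (s : G ⧸ H) : ∃ q : Monoid.Coprod K B, (γ g s = 1 → q = 1) ∧
      (∀ hY : g ∈ Y, ∀ hs : s ∈ R,
        q = Monoid.Coprod.inl ⟨γ g s, hK (Subgroup.subset_closure hY) hs⟩) ∧
      (g ∈ X → ¬(g ∈ Y ∧ s ∈ R) → ∃ h : γ g s ∈ B, q = Monoid.Coprod.inr ⟨γ g s, h⟩) := by
    by_cases h : g ∈ Y ∧ s ∈ R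
    · refine ⟨Monoid.Coprod.inl ⟨γ g s, hK (Subgroup.subset_closure h.1) h.2⟩, fun h1 ↦ ?_,
        fun _ _ ↦ rfl, fun _ h' ↦ absurd h h'⟩
      simp only [h1]
      exact map_one _
    by_cases hg : g ∈ X
    · have hB : γ g s ∈ B := Subgroup.subset_closure ⟨g, hg, s, h, rfl⟩
      refine ⟨Monoid.Coprod.inr ⟨γ g s, hB⟩, fun h1 ↦ ?_, fun h1 h2 ↦ absurd ⟨h1, h2⟩ h,
        fun _ _ ↦ ⟨hB, rfl⟩⟩
      simp only [h1]
      exact map_one _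
    · exact ⟨1, fun _ ↦ rfl, fun h1 h2 ↦ absurd ⟨h1, h2⟩ h, fun h1 ↦ absurd h1 hg⟩
  choose c₀ hc₀one hc₀K hc₀B using label
  obtain ⟨c, c_mul, hc⟩ := exists_cocycle hX (fun f ↦ hfree f) c₀
  have c_one (s : G ⧸ H) : c 1 s = 1 := by simpa using c_mul 1 1 s
  have c_inv (g : G) (s : G ⧸ H) : c g⁻¹ (g • s) = (c g s)⁻¹ := by
    rw [eq_inv_iff_mul_eq_one, ← c_mul, inv_mul_cancel, c_one]
  have c_t : ∀ s, c (t s) ((1 : G) : G ⧸ H) = 1 := by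
    refine hind _ (by rw [hto, c_one]) fun x hx s h ↦ ?_
    have : γ x s = 1 := Subtype.ext (by simp [hγ, h])
    rw [h, c_mul, hts, hc x hx, hc₀one _ _ this, one_mul]
  have c_γ (g : G) (s : G ⧸ H) : c (γ g s) ((1 : G) : G ⧸ H) = c g s := by
    have h := c_inv (t (g • s)) ((1 : G) : G ⧸ H)
    rw [hts, c_t, inv_one] at h
    rw [hγ, mul_assoc, c_mul, c_mul, c_t, mul_smul, hts, h, one_mul, mul_one]
  have smul_base (h : H) : (h : G) • ((1 : G) : G ⧸ H) = ((1 : G) : G ⧸ H) := by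
    rw [MulAction.Quotient.smul_coe, smul_eq_mul, mul_one, QuotientGroup.eq]
    simp
  have γ_base (h : H) : γ h ((1 : G) : G ⧸ H) = h :=
    Subtype.ext (by rw [hγ, smul_base, hto]; simp)
  let ψ : H →* Monoid.Coprod K B :=
    { toFun := fun h ↦ c h ((1 : G) : G ⧸ H)
      map_one' := c_one _
      map_mul' := fun g h ↦ by rw [Subgroup.coe_mul, c_mul, smul_base] }
  have c_K (a : G) (ha : a ∈ Subgroup.closure Y) : ∀ s (hs : s ∈ R),
      c a s = Monoid.Coprod.inl ⟨γ a s, hK ha hs⟩ := by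
    induction ha using Subgroup.closure_induction with
    | mem x hx => exact fun s hs ↦ (hc x (hYX hx) s).trans (hc₀K x s hx hs)
    | one =>
      intro s hs
      simp only [γ_one, c_one]
      exact (map_one _).symm
    | mul x y hx hy h1 h2 =>
      intro s hs
      rw [c_mul, h1 _ (hR y hy s hs), h2 s hs, ← map_mul]
      exact congrArg _ (Subtype.ext (γ_mul x y s).symm)
    | inv x hx h1 =>
      intro s hs
      have hs' := hR _ (inv_mem hx) s hs
      have := c_inv x (x⁻¹ • s)
      rw [smul_inv_smul, h1 _ hs', ← map_inv] at this
      rw [this]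
      exact congrArg _ (Subtype.ext (γ_inv x s).symm)
  refine .of_retraction (B := B) ?_ ψ (fun k ↦ ?_) fun b ↦ ?_
  · have hall (g : G) : ∀ s, γ g s ∈ K ⊔ B := by
      have hg : g ∈ Subgroup.closure X := hX ▸ Subgroup.mem_top g
      induction hg using Subgroup.closure_induction with
      | mem x hx =>
        intro s
        by_cases h : x ∈ Y ∧ s ∈ R
        · exact (le_sup_left : K ≤ K ⊔ B) (hK (Subgroup.subset_closure h.1) h.2)
        · exact (le_sup_right : B ≤ K ⊔ B) (Subgroup.subset_closure ⟨x, hx, s, h, rfl⟩)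
      | one => exact fun s ↦ γ_one s ▸ one_mem _
      | mul x y _ _ h1 h2 => exact fun s ↦ γ_mul x y s ▸ mul_mem (h1 _) (h2 _)
      | inv x _ h1 =>
        intro s
        rw [γ_inv]
        exact inv_mem (h1 _)
    exact eq_top_iff.2 fun h _ ↦ γ_base h ▸ hall h _
  · have h := c_K k k.2 ((1 : G) : G ⧸ H) hoR
    exact h.trans (congrArg _ (Subtype.ext (γ_base k)))
  · have h : B ≤ ((ψ.comp B.subtype).eqLocus Monoid.Coprod.inr).map B.subtype := by
      refine (Subgroup.closure_le _).2 ?_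
      rintro _ ⟨x, hx, s, hxs, rfl⟩
      obtain ⟨hB, h⟩ := hc₀B x s hx hxs
      exact ⟨⟨γ x s, hB⟩, (c_γ x s).trans ((hc x hx s).trans h), rfl⟩
    obtain ⟨b', hb', h⟩ := h b.2
    obtain rfl : b' = b := Subtype.ext h
    exact hb'

theorem IsFreeFactor.inf {G : Type*} [Group G] [IsFreeGroup G] {A B : Subgroup G}
    (hA : IsFreeFactor A) (hB : IsFreeFactor B) : IsFreeFactor (A ⊓ B) := by
  rw [← Subgroup.subgroupOf_map_subtype]
  exact hB.map_subtype (hA.subgroupOf B)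

theorem IsFreeGroup.exists_hom_ne_one {G : Type*} [Group G] [IsFreeGroup G] [Nontrivial G] :
    ∃ f : G →* Multiplicative (ZMod 2), f ≠ 1 := by
  have : Nonempty (IsFreeGroup.Generators G) := by
    by_contra h
    rw [not_nonempty_iff] at h
    have := (IsFreeGroup.mulEquiv G).symm.injective.subsingleton
    exact not_subsingleton G this
  obtain ⟨i⟩ := this
  refine ⟨IsFreeGroup.lift fun _ ↦ Multiplicative.ofAdd 1, fun h ↦ ?_⟩
  have h1 := IsFreeGroup.lift_of (fun _ : IsFreeGroup.Generators G ↦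
    (Multiplicative.ofAdd 1 : Multiplicative (ZMod 2))) i
  rw [h, MonoidHom.one_apply] at h1
  exact absurd h1 (by decide)

/-- Homomorphisms to `ℤ/2` detect proper inclusions of free factors. -/
theorem IsFreeFactor.exists_hom_of_lt {G : Type*} [Group G] [IsFreeGroup G] {A A' : Subgroup G}
    (hA : IsFreeFactor A) (hA' : IsFreeFactor A') (h : A < A') :
    ∃ f : G →* Multiplicative (ZMod 2), A ≤ f.ker ∧ ¬A' ≤ f.ker := by
  obtain ⟨_, -, lift'⟩ := hA'.exists_lift
  obtain ⟨B, hAB, lift⟩ := (hA.subgroupOf A').exists_lift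
  have : Nontrivial B := by
    rw [Subgroup.nontrivial_iff_ne_bot]
    rintro rfl
    rw [sup_bot_eq, Subgroup.subgroupOf_eq_top] at hAB
    exact h.not_ge hAB
  obtain ⟨f, hf⟩ := IsFreeGroup.exists_hom_ne_one (G := B)
  obtain ⟨g, hgA, hgB⟩ := lift (1 : A.subgroupOf A' →* _) f
  obtain ⟨k, hk, -⟩ := lift' g 1
  refine ⟨k, fun a ha ↦ ?_, fun hle ↦ hf ?_⟩
  · exact (hk ⟨a, h.le ha⟩).trans (hgA ⟨⟨a, h.le ha⟩, ha⟩)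
  · ext b
    rw [← hgB, ← hk]
    exact congrArg _ (hle b.1.2)

theorem isFreeFactor_iInf {N : ℕ} {ι : Sort*} (A : ι → Subgroup (FreeGroup (Fin N)))
    (hA : ∀ i, IsFreeFactor (A i)) : IsFreeFactor (⨅ i, A i) := by
  let M := Multiplicative (ZMod 2)
  have : Finite (FreeGroup (Fin N) →* M) := .of_equiv (Fin N → M) FreeGroup.lift
  let ann (B : Subgroup (FreeGroup (Fin N))) : Set (FreeGroup (Fin N) →* M) := {f | B ≤ f.ker}
  obtain ⟨B, ⟨hB, hle⟩, hmax⟩ := (InvImage.wf ann wellFounded_gt).has_min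
    {B | IsFreeFactor B ∧ ⨅ i, A i ≤ B} ⟨⊤, isFreeFactor_top, le_top⟩
  suffices h : ∀ i, B ≤ A i by rwa [le_antisymm hle (le_iInf h)]
  intro i
  by_contra hi
  obtain ⟨f, hf, hf'⟩ := (hB.inf (hA i)).exists_hom_of_lt hB (inf_lt_left.2 hi)
  exact hmax (B ⊓ A i) ⟨hB.inf (hA i), le_inf hle (iInf_le A i)⟩
    ⟨fun _ (h : B ≤ _) ↦ (inf_le_left : B ⊓ A i ≤ B).trans h, fun h ↦ hf' (h hf)⟩

/-- In a free group F_N of finite rank N, the intersection of any family of free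
factors of F_N is again a free factor. Consequently, every subgroup H of F_N is contained in a
unique minimal free factor of F_N, namely the intersection of all free factors containing H. -/
theorem stmt12.{u} (N : ℕ) :
    (∀ (ι : Type u) (A : ι → Subgroup (FreeGroup (Fin N))),
      (∀ i : ι, IsFreeFactor (A i)) → IsFreeFactor (⨅ i, A i)) ∧
    ∀ H : Subgroup (FreeGroup (Fin N)),
      (∃! A : Subgroup (FreeGroup (Fin N)), IsFreeFactor A ∧ H ≤ A ∧
          ∀ A' : Subgroup (FreeGroup (Fin N)), IsFreeFactor A' → H ≤ A' → A ≤ A') ∧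
      (⨅ (A : Subgroup (FreeGroup (Fin N))) (_ : IsFreeFactor A) (_ : H ≤ A), A) ∈
        {A : Subgroup (FreeGroup (Fin N)) | IsFreeFactor A ∧ H ≤ A ∧
          ∀ A', IsFreeFactor A' → H ≤ A' → A ≤ A'} := by
  refine ⟨fun ι A hA ↦ isFreeFactor_iInf A hA, fun H ↦ ?_⟩
  have key : IsFreeFactor (⨅ (A : Subgroup (FreeGroup (Fin N))) (_ : IsFreeFactor A)
      (_ : H ≤ A), A) :=
    isFreeFactor_iInf _ fun A ↦ isFreeFactor_iInf _ fun hA ↦ isFreeFactor_iInf _ fun _ ↦ hA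
  have hle : H ≤ ⨅ (A : Subgroup (FreeGroup (Fin N))) (_ : IsFreeFactor A) (_ : H ≤ A), A :=
    le_iInf fun _ ↦ le_iInf fun _ ↦ le_iInf id
  have hmin (A' : Subgroup (FreeGroup (Fin N))) (hA' : IsFreeFactor A') (h : H ≤ A') :
      ⨅ (A : Subgroup (FreeGroup (Fin N))) (_ : IsFreeFactor A) (_ : H ≤ A), A ≤ A' :=
    (iInf_le _ A').trans ((iInf_le _ hA').trans (iInf_le _ h))
  exact ⟨⟨_, ⟨key, hle, hmin⟩, fun A ⟨h1, h2, h3⟩ ↦ le_antisymm (h3 _ key hle) (hmin A h1 h2)⟩,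
    key, hle, hmin⟩
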